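/- The derivative of the transformed potential V₀(x) = 2·h₀(x)² − 2·μ₀² − V(x), where h₀ = φ₀'/φ₀, is an odd function and satisfies V₀'(x) ≤ 0 for every x ≥ 0; in particular V₀ is repulsive, i.e. x·V₀'(x) ≤ 0 for all x ∈ ℝ. -/

import Mathlib

open Real MeasureTheory Filter

noncomputable def Qs (x : ℝ) : ℝ := (3/2) * (1 / Real.cosh (x/2))^2
noncomputable def Hs (x : ℝ) : ℝ := Real.tanh (x/2)
noncomputable def alphaFn (x : ℝ) : ℝ := (1/3) * (Real.sinh x + x)
noncomputable def alphaInv : ℝ → ℝ := Function.invFun alphaFn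
noncomputable def Qt (x : ℝ) : ℝ := Qs (alphaInv x)
noncomputable def Ht (x : ℝ) : ℝ := Hs (alphaInv x)
noncomputable def Vpot (x : ℝ) : ℝ := 2 * (Qt x)^2 * (1 - Qt x)

theorem repulsivity_of_slope_le {Q t w m : ℝ} (ht : t ^ 2 = 1 - 2 * Q / 3) (ht0 : 0 ≤ t)
    (hQ : 33 / 25 ≤ Q) (hQ' : Q ≤ 3 / 2) (hm : 0.652864 ≤ m) (hm' : m ≤ 0.779689)
    (hw : 0 ≤ w) (hwt : w ≤ 2.13 * t) :
    4 * w * (w ^ 2 - 2 * Q ^ 2 * (1 - Q) - m) ≤ 2 * Q ^ 3 * t * (3 * Q - 2) := by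
  have hA : 0 ≤ w ^ 2 - 2 * Q ^ 2 * (1 - Q) - m := by nlinarith [sq_nonneg w]
  have hsq : w ^ 2 ≤ 2.13 ^ 2 * (1 - 2 * Q / 3) := by
    rw [← ht]; nlinarith
  have key : 4 * 2.13 * (2.13 ^ 2 * (1 - 2 * Q / 3) - 2 * Q ^ 2 * (1 - Q) - 0.652864)
      ≤ 2 * Q ^ 3 * (3 * Q - 2) := by
    nlinarith [mul_nonneg (sub_nonneg.2 hQ) (sub_nonneg.2 hQ'),
      mul_nonneg (mul_nonneg (sub_nonneg.2 hQ) (sub_nonneg.2 hQ')) (sub_nonneg.2 hQ),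
      sq_nonneg (Q - 1.4), sq_nonneg (Q ^ 2 - 2)]
  calc 4 * w * (w ^ 2 - 2 * Q ^ 2 * (1 - Q) - m)
      ≤ 4 * (2.13 * t) * (2.13 ^ 2 * (1 - 2 * Q / 3) - 2 * Q ^ 2 * (1 - Q) - 0.652864) := by
        gcongr
    _ = t * (4 * 2.13 * (2.13 ^ 2 * (1 - 2 * Q / 3) - 2 * Q ^ 2 * (1 - Q) - 0.652864)) := by ring
    _ ≤ t * (2 * Q ^ 3 * (3 * Q - 2)) := by gcongr
    _ = _ := by ring

theorem linear_barrier_slope {Q t m : ℝ} (ht : t ^ 2 = 1 - 2 * Q / 3)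
    (hQ : 33 / 25 ≤ Q) (hQ' : Q ≤ 3 / 2) (hm : 0.652864 ≤ m) :
    (2.13 * t) ^ 2 - 2 * Q ^ 2 * (1 - Q) - m < 2.13 * (Q ^ 2 / 3) := by
  rw [mul_pow, ht]
  nlinarith [mul_nonneg (sub_nonneg.2 hQ) (sub_nonneg.2 hQ'),
    mul_nonneg (mul_nonneg (sub_nonneg.2 hQ) (sub_nonneg.2 hQ')) (sub_nonneg.2 hQ),
    sq_nonneg (Q - 1.4)]

theorem critical_slope_pos {Q t w m : ℝ} (ht : t ^ 2 = 1 - 2 * Q / 3) (ht0 : 0 < t)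
    (hQ0 : 0 < Q) (hQ : Q ≤ 33 / 25) (hm : 0.652864 ≤ m) (hm' : m ≤ 0.779689) (hw : 0 < w)
    (hcrit : 4 * w * (w ^ 2 - 2 * Q ^ 2 * (1 - Q) - m) = 2 * Q ^ 3 * t * (3 * Q - 2)) :
    0 < 4 * (w ^ 2 - 2 * Q ^ 2 * (1 - Q) - m) ^ 2
      - 8 * w ^ 2 * (w ^ 2 - 2 * Q ^ 2 * (1 - Q) - m)
      - Q ^ 4 * (18 * Q ^ 2 - 100 / 3 * Q + 12) := by
  obtain hb | hb := le_or_gt (2 / 3) Q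
  · have hwt : w ≤ (12 / 5) * t := by
      by_contra! h
      have hsq : ((12 / 5) * t) ^ 2 < w ^ 2 := by gcongr
      have key : 2 * Q ^ 3 * (3 * Q - 2)
          ≤ 4 * (12 / 5) * ((12 / 5) ^ 2 * (1 - 2 * Q / 3) - 2 * Q ^ 2 * (1 - Q) - 0.779689) := by
        nlinarith [mul_nonneg (sub_nonneg.2 hQ) (sub_nonneg.2 hb),
          mul_nonneg (mul_nonneg (sub_nonneg.2 hQ) (sub_nonneg.2 hb)) (sub_nonneg.2 hb),
          sq_nonneg (Q - 1), sq_nonneg (Q ^ 2 - 1)]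
      rw [mul_pow, ht] at hsq
      have hnn : 0 ≤ 2 * Q ^ 3 * (3 * Q - 2) := by
        have : 0 ≤ 3 * Q - 2 := by linarith
        positivity
      have hlt : (12 / 5) ^ 2 * (1 - 2 * Q / 3) - 2 * Q ^ 2 * (1 - Q) - 0.779689
          < w ^ 2 - 2 * Q ^ 2 * (1 - Q) - m := by linarith
      have hlt2 : 0 ≤ (12 / 5) ^ 2 * (1 - 2 * Q / 3) - 2 * Q ^ 2 * (1 - Q) - 0.779689 := by linarith
      nlinarith [mul_lt_mul'' h hlt (by positivity) hlt2]
    set p := w ^ 2 - 2 * Q ^ 2 * (1 - Q) - m with hp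
    have hb' : 0 ≤ 3 * Q - 2 := by linarith
    have hp0 : 5 / 24 * (Q ^ 3 * (3 * Q - 2)) ≤ p := by
      have h1 : 0 ≤ 4 * w * p := by rw [hcrit]; positivity
      have h2 : 0 ≤ p := by
        by_contra! h; nlinarith [mul_pos hw (neg_pos.2 h)]
      have h3 : 2 * Q ^ 3 * t * (3 * Q - 2) ≤ 4 * ((12 / 5) * t) * p := by
        rw [← hcrit]; gcongr
      nlinarith
    have h8 : 8 * w ^ 2 * p ≤ 48 / 5 * (1 - 2 * Q / 3) * Q ^ 3 * (3 * Q - 2) := by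
      calc 8 * w ^ 2 * p = 2 * w * (4 * w * p) := by ring
        _ = 2 * w * (2 * Q ^ 3 * t * (3 * Q - 2)) := by rw [hcrit]
        _ ≤ 2 * ((12 / 5) * t) * (2 * Q ^ 3 * t * (3 * Q - 2)) := by gcongr
        _ = 48 / 5 * t ^ 2 * Q ^ 3 * (3 * Q - 2) := by ring
        _ = _ := by rw [ht]
    have h4 : (5 / 24 * (Q ^ 3 * (3 * Q - 2))) ^ 2 ≤ p ^ 2 := by gcongr
    have key : 0 < 25 / 144 * Q ^ 3 * (3 * Q - 2) ^ 2 - 48 / 5 * (1 - 2 * Q / 3) * (3 * Q - 2)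
        - Q * (18 * Q ^ 2 - 100 / 3 * Q + 12) := by
      have hu : 0 ≤ Q - 2 / 3 := by linarith
      have hv : 0 ≤ 33 / 25 - Q := by linarith
      nlinarith [pow_nonneg hu 5, mul_nonneg (pow_nonneg hu 4) hv,
        mul_nonneg (pow_nonneg hu 3) (pow_nonneg hv 2),
        mul_nonneg (pow_nonneg hu 2) (pow_nonneg hv 3), mul_nonneg hu (pow_nonneg hv 4),
        pow_nonneg hv 5]
    have hmul := mul_pos (pow_pos hQ0 3) key
    ring_nf at hmul h4 h8 ⊢
    linarith
  · set p := w ^ 2 - 2 * Q ^ 2 * (1 - Q) - m with hp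
    have hV : 0 ≤ 2 * Q ^ 2 * (1 - Q) := by
      have : 0 ≤ 1 - Q := by linarith
      positivity
    obtain hw4 | hw4 := le_or_gt 0.4 w
    · have h8 : 8 * w ^ 2 * (-p) ≥ 1.6 * Q ^ 3 * (1 - 2 * Q / 3) * (2 - 3 * Q) := by
        have : 0 ≤ 2 - 3 * Q := by linarith
        have ht1 : t ≤ 1 := by nlinarith
        calc 8 * w ^ 2 * (-p) = 2 * w * -(4 * w * p) := by ring
          _ = 2 * w * (2 * Q ^ 3 * t * (2 - 3 * Q)) := by rw [hcrit]; ring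
          _ ≥ 2 * 0.4 * (2 * Q ^ 3 * t * (2 - 3 * Q)) := by gcongr
          _ ≥ 2 * 0.4 * (2 * Q ^ 3 * t ^ 2 * (2 - 3 * Q)) := by
            gcongr; nlinarith
          _ = _ := by rw [ht]; ring
      have key : 0 < 1.6 * (1 - 2 * Q / 3) * (2 - 3 * Q)
          - Q * (18 * Q ^ 2 - 100 / 3 * Q + 12) := by
        nlinarith [mul_pos hQ0 (sub_pos.2 hb),
          mul_pos (mul_pos hQ0 (sub_pos.2 hb)) hQ0,
          sq_nonneg (Q - 0.4), sq_nonneg (Q - 0.3)]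
      nlinarith [mul_pos (pow_pos hQ0 3) key, sq_nonneg p]
    · have hp4 : p ≤ -0.49 := by nlinarith
      have h1 : Q ^ 4 * (18 * Q ^ 2 - 100 / 3 * Q + 12) ≤ 0.9 := by
        have h2 : Q ^ 3 ≤ (2 / 3) ^ 3 := by gcongr
        have h3 : Q * (18 * Q ^ 2 - 100 / 3 * Q + 12) ≤ 2 := by
          nlinarith [mul_pos hQ0 (sub_pos.2 hb)]
        have hQ3 := pow_pos hQ0 3
        calc Q ^ 4 * (18 * Q ^ 2 - 100 / 3 * Q + 12)
            = Q ^ 3 * (Q * (18 * Q ^ 2 - 100 / 3 * Q + 12)) := by ring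
          _ ≤ Q ^ 3 * 2 := by gcongr
          _ ≤ 0.9 := by linarith
      have hneg : 0 < w ^ 2 * -p := mul_pos (pow_pos hw 2) (by linarith)
      have hsq : 0.49 ^ 2 ≤ p ^ 2 := by nlinarith
      linarith

theorem strictMono_alphaFn : StrictMono alphaFn := fun x y hxy => by
  have := sinh_strictMono hxy
  unfold alphaFn
  linarith

theorem continuous_alphaFn : Continuous alphaFn := by
  unfold alphaFn
  fun_prop

theorem tendsto_alphaFn_atTop : Tendsto alphaFn atTop atTop :=
  (sinhOrderIso.tendsto_atTop.atTop_add_atTop tendsto_id).const_mul_atTop (by norm_num)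

theorem alphaFn_neg (x : ℝ) : alphaFn (-x) = -alphaFn x := by
  simp only [alphaFn, sinh_neg]
  ring

theorem surjective_alphaFn : Function.Surjective alphaFn := by
  refine continuous_alphaFn.surjective tendsto_alphaFn_atTop ?_
  have h := tendsto_neg_atTop_atBot.comp (tendsto_alphaFn_atTop.comp tendsto_neg_atBot_atTop)
  refine h.congr fun x => ?_
  simp [alphaFn_neg]

theorem alphaInv_alphaFn (x : ℝ) : alphaInv (alphaFn x) = x :=
  Function.leftInverse_invFun strictMono_alphaFn.injective x

theorem alphaFn_alphaInv (x : ℝ) : alphaFn (alphaInv x) = x :=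
  Function.rightInverse_invFun surjective_alphaFn x

theorem alphaInv_neg (x : ℝ) : alphaInv (-x) = -alphaInv x := by
  apply strictMono_alphaFn.injective
  rw [alphaFn_neg, alphaFn_alphaInv, alphaFn_alphaInv]

theorem strictMono_alphaInv : StrictMono alphaInv := fun x y hxy => by
  rwa [← strictMono_alphaFn.lt_iff_lt, alphaFn_alphaInv, alphaFn_alphaInv]

theorem continuous_alphaInv : Continuous alphaInv :=
  strictMono_alphaInv.monotone.continuous_of_surjective fun x => ⟨_, alphaInv_alphaFn x⟩

theorem tendsto_alphaInv_atTop : Tendsto alphaInv atTop atTop :=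
  tendsto_atTop_atTop_of_monotone strictMono_alphaInv.monotone fun b =>
    ⟨alphaFn b, (alphaInv_alphaFn b).ge⟩

theorem Qs_pos (x : ℝ) : 0 < Qs x := by
  have := cosh_pos (x / 2)
  unfold Qs
  positivity

theorem Qt_pos (x : ℝ) : 0 < Qt x := Qs_pos _

theorem Hs_sq (x : ℝ) : Hs x ^ 2 = 1 - 2 * Qs x / 3 := by
  have hc := (cosh_pos (x / 2)).ne'
  have := cosh_sq (x / 2)
  rw [Hs, Qs, tanh_eq_sinh_div_cosh]
  field_simp
  linarith

theorem Ht_sq (x : ℝ) : Ht x ^ 2 = 1 - 2 * Qt x / 3 := Hs_sq _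

theorem Qt_le (x : ℝ) : Qt x ≤ 3 / 2 := by
  have := Ht_sq x
  nlinarith [sq_nonneg (Ht x)]

theorem hasDerivAt_alphaFn (x : ℝ) : HasDerivAt alphaFn (Qs x)⁻¹ x := by
  refine (((hasDerivAt_sinh x).add (hasDerivAt_id x)).const_mul (1 / 3)).congr_deriv ?_
  have hc := (cosh_pos (x / 2)).ne'
  have h1 : cosh x = cosh (x / 2) ^ 2 + sinh (x / 2) ^ 2 := by
    rw [← cosh_two_mul]
    ring_nf
  have h2 := cosh_sq (x / 2)
  rw [h1, Qs]
  field_simp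
  linarith

theorem hasDerivAt_alphaInv (x : ℝ) : HasDerivAt alphaInv (Qt x) x := by
  have h := HasDerivAt.of_local_left_inverse continuous_alphaInv.continuousAt
    (hasDerivAt_alphaFn (alphaInv x)) (inv_ne_zero (Qs_pos _).ne')
    (Eventually.of_forall alphaFn_alphaInv)
  rwa [inv_inv] at h

theorem hasDerivAt_Qs (x : ℝ) : HasDerivAt Qs (-(Qs x * Hs x)) x := by
  have hc := (cosh_pos (x / 2)).ne'
  have h : HasDerivAt (fun y : ℝ => cosh (y / 2)) (sinh (x / 2) * (1 / 2)) x :=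
    ((hasDerivAt_id x).div_const 2).cosh
  refine ((((hasDerivAt_const x (1 : ℝ)).div h hc).pow 2).const_mul (3 / 2)).congr_deriv ?_
  rw [Qs, Hs, tanh_eq_sinh_div_cosh]
  simp only [Pi.div_apply, Nat.cast_ofNat, Nat.add_one_sub_one, pow_one]
  field_simp
  ring

theorem hasDerivAt_Hs (x : ℝ) : HasDerivAt Hs (Qs x / 3) x := by
  have hc := (cosh_pos (x / 2)).ne'
  have h1 : HasDerivAt (fun y : ℝ => cosh (y / 2)) (sinh (x / 2) * (1 / 2)) x :=
    ((hasDerivAt_id x).div_const 2).cosh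
  have h2 : HasDerivAt (fun y : ℝ => sinh (y / 2)) (cosh (x / 2) * (1 / 2)) x :=
    ((hasDerivAt_id x).div_const 2).sinh
  have h := h2.div h1 hc
  have hfun : Hs = (fun y : ℝ => sinh (y / 2)) / fun y : ℝ => cosh (y / 2) := by
    funext y
    simp [Hs, tanh_eq_sinh_div_cosh]
  rw [hfun]
  refine h.congr_deriv ?_
  have := cosh_sq (x / 2)
  rw [Qs]
  field_simp
  linarith

theorem hasDerivAt_Qt (x : ℝ) : HasDerivAt Qt (-(Qt x ^ 2 * Ht x)) x :=
  ((hasDerivAt_Qs _).comp x (hasDerivAt_alphaInv x)).congr_deriv (by simp only [Qt, Ht]; ring)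

theorem hasDerivAt_Ht (x : ℝ) : HasDerivAt Ht (Qt x ^ 2 / 3) x :=
  ((hasDerivAt_Hs _).comp x (hasDerivAt_alphaInv x)).congr_deriv (by simp only [Qt]; ring)

theorem strictMono_Ht : StrictMono Ht :=
  strictMono_of_hasDerivAt_pos hasDerivAt_Ht fun x => by have := Qt_pos x; positivity

theorem alphaInv_zero : alphaInv 0 = 0 := by
  have h := alphaInv_alphaFn 0
  rwa [show alphaFn 0 = 0 by simp [alphaFn]] at h

theorem Ht_zero : Ht 0 = 0 := by simp [Ht, Hs, alphaInv_zero]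

theorem Ht_pos {x : ℝ} (hx : 0 < x) : 0 < Ht x := Ht_zero ▸ strictMono_Ht hx

theorem Ht_nonneg {x : ℝ} (hx : 0 ≤ x) : 0 ≤ Ht x := Ht_zero ▸ strictMono_Ht.monotone hx

theorem Qt_le_Qt {x y : ℝ} (hx : 0 ≤ x) (hxy : x ≤ y) : Qt y ≤ Qt x := by
  have h := pow_le_pow_left₀ (Ht_nonneg hx) (strictMono_Ht.monotone hxy) 2
  rw [Ht_sq, Ht_sq] at h
  linarith

theorem Qt_neg (x : ℝ) : Qt (-x) = Qt x := by
  simp only [Qt, Qs, alphaInv_neg, neg_div, cosh_neg]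

theorem Vpot_neg (x : ℝ) : Vpot (-x) = Vpot x := by rw [Vpot, Vpot, Qt_neg]

theorem tendsto_Qt_atTop : Tendsto Qt atTop (nhds 0) := by
  have hcosh : Tendsto cosh atTop atTop :=
    tendsto_atTop_mono (fun x => (sinh_lt_cosh x).le) sinhOrderIso.tendsto_atTop
  have h : Tendsto (fun x => cosh (alphaInv x / 2)) atTop atTop :=
    hcosh.comp (tendsto_alphaInv_atTop.atTop_div_const (by norm_num))
  have h2 := (h.inv_tendsto_atTop.pow 2).const_mul (3 / 2)
  rw [zero_pow two_ne_zero, mul_zero] at h2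
  exact h2.congr fun x => by simp [Qt, Qs]

theorem hasDerivAt_Vpot (x : ℝ) :
    HasDerivAt Vpot (2 * Qt x ^ 3 * Ht x * (3 * Qt x - 2)) x := by
  have h := hasDerivAt_Qt x
  refine (((h.pow 2).const_mul 2).mul (h.const_sub 1)).congr_deriv ?_
  simp only [Pi.pow_apply]
  ring

theorem hasDerivAt_slope_Vpot (x : ℝ) :
    HasDerivAt (fun y => 2 * Qt y ^ 3 * Ht y * (3 * Qt y - 2))
      (Qt x ^ 4 * (18 * Qt x ^ 2 - 100 / 3 * Qt x + 12)) x := by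
  have h := hasDerivAt_Qt x
  refine ((((h.pow 3).const_mul 2).mul (hasDerivAt_Ht x)).mul
    ((h.const_mul 3).sub_const 2)).congr_deriv ?_
  simp only [Pi.pow_apply, Pi.mul_apply]
  linear_combination (12 * Qt x ^ 4 - 24 * Qt x ^ 5) * Ht_sq x

theorem le_of_forall_deriv_le {f f' : ℝ → ℝ} {a c : ℝ} (hf : ∀ x, a ≤ x → HasDerivAt f (f' x) x)
    (hc : ∀ x, a ≤ x → f' x ≤ c) {x : ℝ} (hx : a ≤ x) : f x ≤ f a + c * (x - a) := by
  have hB (y : ℝ) : HasDerivAt (fun z => f a + c * (z - a)) c y :=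
    (((hasDerivAt_id y).sub_const a).const_mul c).const_add (f a) |>.congr_deriv (mul_one c)
  exact image_le_of_deriv_right_le_deriv_boundary (b := x)
    (fun y hy => (hf y hy.1).continuousAt.continuousWithinAt)
    (fun y hy => (hf y hy.1).hasDerivWithinAt) (by simp)
    (fun y _ => (hB y).continuousAt.continuousWithinAt)
    (fun y _ => (hB y).hasDerivWithinAt) (fun y hy => hc y hy.1) ⟨hx, le_rfl⟩

theorem not_forall_pos_of_deriv_le {f f' : ℝ → ℝ} {a c : ℝ}
    (hf : ∀ x, a ≤ x → HasDerivAt f (f' x) x) (hc : 0 < c) (hc' : ∀ x, a ≤ x → f' x ≤ -c) :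
    ¬ ∀ x, a ≤ x → 0 < f x := fun hpos => by
  have ha : a ≤ a + f a / c := by have := hpos a le_rfl; simp; positivity
  have h1 := le_of_forall_deriv_le hf hc' ha
  have h2 := hpos _ ha
  have h3 : -c * (a + f a / c - a) = -f a := by field_simp; ring
  linarith

theorem not_forall_pos_of_mul_sq_le_deriv {f f' : ℝ → ℝ} {a c : ℝ}
    (hf : ∀ x, a ≤ x → HasDerivAt f (f' x) x) (hc : 0 < c)
    (hc' : ∀ x, a ≤ x → c * f x ^ 2 ≤ f' x) : ¬ ∀ x, a ≤ x → 0 < f x := fun hpos => by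
  refine not_forall_pos_of_deriv_le (f := f⁻¹) (f' := fun x => -f' x / f x ^ 2)
    (fun x hx => (hf x hx).inv (hpos x hx).ne') hc (fun x hx => ?_)
    fun x hx => inv_pos.2 (hpos x hx)
  have := hpos x hx
  rw [div_le_iff₀ (by positivity)]
  linarith [hc' x hx]

/-- The properties of `w = -φ₀' / φ₀` that follow from the eigenvalue equation, evenness and
decay of `φ₀`, with `m = μ₀ ^ 2`. -/
structure IsRiccatiSolution (m : ℝ) (w : ℝ → ℝ) : Prop where
  hasDerivAt (x : ℝ) : HasDerivAt w (w x ^ 2 - Vpot x - m) x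
  map_zero : w 0 = 0
  pos {x : ℝ} (hx : 0 < x) : 0 < w x

namespace IsRiccatiSolution

variable {m : ℝ} {w : ℝ → ℝ}

theorem hasDerivAt_potential (h : IsRiccatiSolution m w) (x : ℝ) :
    HasDerivAt (fun y => 2 * w y ^ 2 - 2 * m - Vpot y)
      (4 * w x * (w x ^ 2 - Vpot x - m) - 2 * Qt x ^ 3 * Ht x * (3 * Qt x - 2)) x := by
  refine (((((h.hasDerivAt x).pow 2).const_mul 2).sub_const (2 * m)).sub
    (hasDerivAt_Vpot x)).congr_deriv ?_
  ring

theorem hasDerivAt_slope (h : IsRiccatiSolution m w) (x : ℝ) :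
    HasDerivAt (fun y => 4 * w y * (w y ^ 2 - Vpot y - m) - 2 * Qt y ^ 3 * Ht y * (3 * Qt y - 2))
      (4 * (w x ^ 2 - Vpot x - m) ^ 2 + 4 * w x * (2 * w x * (w x ^ 2 - Vpot x - m)
        - 2 * Qt x ^ 3 * Ht x * (3 * Qt x - 2))
        - Qt x ^ 4 * (18 * Qt x ^ 2 - 100 / 3 * Qt x + 12)) x := by
  have hw := h.hasDerivAt x
  refine (((hw.const_mul 4).mul (((hw.pow 2).sub (hasDerivAt_Vpot x)).sub_const m)).sub
    (hasDerivAt_slope_Vpot x)).congr_deriv ?_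
  simp only [Pi.pow_apply, Pi.sub_apply]
  ring

theorem le_mul_Ht (h : IsRiccatiSolution m w) (hm : 0.652864 ≤ m) {x : ℝ} (hx : 0 ≤ x)
    (hQ : 33 / 25 ≤ Qt x) : w x ≤ 2.13 * Ht x := by
  refine image_le_of_deriv_right_lt_deriv_boundary (a := 0) (b := x)
    (fun y _ => (h.hasDerivAt y).continuousAt.continuousWithinAt)
    (fun y _ => (h.hasDerivAt y).hasDerivWithinAt) (by rw [h.map_zero, Ht_zero]; norm_num)
    (fun y => (hasDerivAt_Ht y).const_mul 2.13) (fun y hy hwy => ?_) ⟨hx, le_rfl⟩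
  rw [hwy, Vpot]
  exact linear_barrier_slope (Ht_sq y) (hQ.trans (Qt_le_Qt hy.1 hy.2.le)) (Qt_le y) hm

theorem slope_nonneg_of_nonneg (h : IsRiccatiSolution m w) (hm : 0.652864 ≤ m)
    (hm' : m ≤ 0.779689) {a x : ℝ} (ha : 0 < a) (hQ : Qt a ≤ 33 / 25)
    (hG : 0 ≤ 4 * w a * (w a ^ 2 - Vpot a - m) - 2 * Qt a ^ 3 * Ht a * (3 * Qt a - 2))
    (hx : a ≤ x) :
    0 ≤ 4 * w x * (w x ^ 2 - Vpot x - m) - 2 * Qt x ^ 3 * Ht x * (3 * Qt x - 2) := by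
  refine image_le_of_deriv_right_lt_deriv_boundary (f := fun _ => (0 : ℝ)) (f' := fun _ => 0)
    (a := a) (b := x) continuousOn_const
    (fun y _ => (hasDerivAt_const y (0 : ℝ)).hasDerivWithinAt) hG h.hasDerivAt_slope
    (fun y hy hGy => ?_) ⟨hx, le_rfl⟩
  have hy0 : 0 < y := ha.trans_le hy.1
  have hcrit : 4 * w y * (w y ^ 2 - Vpot y - m) = 2 * Qt y ^ 3 * Ht y * (3 * Qt y - 2) := by
    linarith
  have hR := critical_slope_pos (Ht_sq y) (Ht_pos hy0) (Qt_pos y)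
    ((Qt_le_Qt ha.le hy.1).trans hQ) hm hm' (h.pos hy0) hcrit
  rw [← hcrit]
  rw [← Vpot] at hR
  linarith

theorem exists_slope_neg (h : IsRiccatiSolution m w) (hm : 0.652864 ≤ m)
    (hm' : m ≤ 0.779689) {a : ℝ} (ha : 0 < a) : ∃ x, a ≤ x ∧
      4 * w x * (w x ^ 2 - Vpot x - m) - 2 * Qt x ^ 3 * Ht x * (3 * Qt x - 2) < 0 := by
  by_contra! hG
  have hsmall {ε : ℝ} (hε : 0 < ε) (b : ℝ) :
      ∃ X, b ≤ X ∧ ∀ x, X ≤ x → Qt x < ε := by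
    obtain ⟨X, hX⟩ := eventually_atTop.1 (tendsto_Qt_atTop.eventually_lt_const hε)
    exact ⟨max b X, le_max_left _ _, fun x hx => hX x ((le_max_right _ _).trans hx)⟩
  have hmono : MonotoneOn (fun y => 2 * w y ^ 2 - 2 * m - Vpot y) (Set.Ici a) :=
    monotoneOn_of_hasDerivWithinAt_nonneg (convex_Ici a)
      (fun y _ => (h.hasDerivAt_potential y).continuousAt.continuousWithinAt)
      (fun y _ => (h.hasDerivAt_potential y).hasDerivWithinAt)
      fun y hy => hG y (interior_subset hy)
  by_cases hV0 : ∃ b, a ≤ b ∧ 0 < 2 * w b ^ 2 - 2 * m - Vpot b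
  · obtain ⟨b, hab, hb⟩ := hV0
    set d := 2 * w b ^ 2 - 2 * m - Vpot b with hd
    obtain ⟨X, hbX, hX⟩ := hsmall (ε := min (1 / 4) d) (by positivity) b
    refine not_forall_pos_of_mul_sq_le_deriv (a := X) (c := (1 + 8 / d)⁻¹)
      (fun x _ => h.hasDerivAt x) (by positivity) (fun x hx => ?_)
      fun x hx => h.pos (by linarith)
    have hVx : d ≤ 2 * w x ^ 2 - 2 * m - Vpot x := hmono hab (hab.trans (hbX.trans hx))
      (hbX.trans hx)
    obtain ⟨hQ1, hQ2⟩ := lt_min_iff.1 (hX x hx)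
    have hQ0 := Qt_pos x
    have hV1 : Vpot x ≤ Qt x / 2 := by
      rw [Vpot]; nlinarith [pow_pos hQ0 3, mul_pos hQ0 (sub_pos.2 hQ1)]
    have hp : d / 4 ≤ w x ^ 2 - Vpot x - m := by linarith
    rw [inv_mul_le_iff₀ (by positivity)]
    have h8 : 8 / d * (d / 4) ≤ 8 / d * (w x ^ 2 - Vpot x - m) := by gcongr
    have h2 : 8 / d * (d / 4) = 2 := by field_simp; norm_num
    linarith
  · push Not at hV0
    obtain ⟨X, haX, hX⟩ := hsmall (ε := 1 / 4) (by norm_num) a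
    refine not_forall_pos_of_deriv_le (a := X) (c := 1 / 2) (fun x _ => h.hasDerivAt x)
      (by norm_num) (fun x hx => ?_) fun x hx => h.pos (by linarith)
    have hx0 : a ≤ x := haX.trans hx
    have hQ0 := Qt_pos x
    have hQ1 := hX x hx
    have hw := h.pos (ha.trans_le hx0)
    have hV := hV0 x hx0
    have hGx := hG x hx0
    have hV1 : 0 ≤ Vpot x := by
      have : 0 ≤ 1 - Qt x := by linarith
      rw [Vpot]; positivity
    have hH0 := Ht_pos (ha.trans_le hx0)
    have hH1 : Ht x ≤ 1 := by nlinarith [Ht_sq x]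
    have h1 : 2 * w x * Vpot x ≤ 2 * Qt x ^ 3 * Ht x * (2 - 3 * Qt x) := by
      have : w x * (w x ^ 2 - Vpot x - m) ≤ w x * (-(Vpot x / 2)) := by gcongr; linarith
      linarith
    have h2 : 2 * Qt x ^ 3 * Ht x * (2 - 3 * Qt x) ≤ 2 * Qt x ^ 3 * 1 * (2 - 2 * Qt x) := by
      have : 0 ≤ 2 - 3 * Qt x := by linarith
      gcongr
      norm_num
    have h3 : w x ≤ Qt x := by
      have hpos : 0 < 4 * Qt x ^ 2 * (1 - Qt x) := by
        have : 0 < 1 - Qt x := by linarith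
        positivity
      refine le_of_mul_le_mul_left ?_ hpos
      rw [Vpot] at h1
      linarith
    nlinarith

theorem slope_nonpos (h : IsRiccatiSolution m w) (hm : 0.652864 ≤ m) (hm' : m ≤ 0.779689)
    {x : ℝ} (hx : 0 ≤ x) :
    4 * w x * (w x ^ 2 - Vpot x - m) - 2 * Qt x ^ 3 * Ht x * (3 * Qt x - 2) ≤ 0 := by
  obtain rfl | hx0 := hx.eq_or_lt
  · simp [h.map_zero, Ht_zero]
  obtain hQ | hQ := le_total (33 / 25) (Qt x)
  · rw [sub_nonpos, Vpot]
    exact repulsivity_of_slope_le (Ht_sq x) (Ht_nonneg hx) hQ (Qt_le x) hm hm' (h.pos hx0).le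
      (h.le_mul_Ht hm hx hQ)
  · by_contra! hG
    obtain ⟨y, hxy, hy⟩ := h.exists_slope_neg hm hm' hx0
    exact hy.not_ge (h.slope_nonneg_of_nonneg hm hm' hx0 hQ hG.le hxy)

end IsRiccatiSolution

theorem Vpot_add_nonneg_of_le {m x y : ℝ} (hm : 0 ≤ m) (hx : 0 ≤ x) (hxy : x ≤ y)
    (h : 0 ≤ Vpot x + m) : 0 ≤ Vpot y + m := by
  by_contra! hy
  have hQ := Qt_le_Qt hx hxy
  have hy1 : 1 < Qt y := by
    by_contra! hle
    have : 0 ≤ 1 - Qt y := by linarith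
    have : 0 ≤ Vpot y := by rw [Vpot]; positivity
    linarith
  have : Vpot x ≤ Vpot y := by
    simp only [Vpot]
    have h1 : Qt y ^ 2 ≤ Qt x ^ 2 := pow_le_pow_left₀ (by linarith) hQ 2
    nlinarith [mul_le_mul h1 (sub_le_sub_right hQ 1) (by linarith) (by positivity)]
  linarith

theorem tendsto_zero_of_exp_decay {φ : ℝ → ℝ} {μ : ℝ} (hμ : 0 < μ)
    (hdecay : ∃ C > (0:ℝ), ∀ x : ℝ,
      |φ x| + |deriv φ x| ≤ C * Real.exp (-(Real.sqrt 2 / 2) * μ * |x|)) :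
    Tendsto φ atTop (nhds 0) := by
  obtain ⟨C, -, hC⟩ := hdecay
  have hexp : Tendsto (fun x : ℝ => C * exp (-(√2 / 2 * μ * |x|))) atTop (nhds (C * 0)) :=
    (tendsto_exp_neg_atTop_nhds_zero.comp
      (tendsto_abs_atTop_atTop.const_mul_atTop (by positivity))).const_mul C
  rw [mul_zero] at hexp
  refine squeeze_zero_norm (fun x => ?_) hexp
  have := hC x
  rw [show -(√2 / 2) * μ * |x| = -(√2 / 2 * μ * |x|) by ring] at this
  exact (le_add_of_nonneg_right (abs_nonneg _)).trans this

/-- A positive even decaying solution of `φ'' = (V + m) φ` is strictly decreasing on `(0, ∞)`. -/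
theorem deriv_neg_of_tendsto_zero {φ : ℝ → ℝ} {m : ℝ} (hC2 : ContDiff ℝ 2 φ)
    (hpos : ∀ x, 0 < φ x) (hm : 0 ≤ m) (hφ0 : deriv φ 0 = 0)
    (heq : ∀ x, deriv (deriv φ) x = (Vpot x + m) * φ x) (hlim : Tendsto φ atTop (nhds 0))
    {x : ℝ} (hx : 0 < x) : deriv φ x < 0 := by
  have hdφ : Differentiable ℝ φ := hC2.differentiable (by norm_num)
  have hdφ' : Differentiable ℝ (deriv φ) := hC2.differentiable_deriv_two
  by_contra! hge
  obtain hA | hA := le_or_gt 0 (Vpot x + m)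
  · have hmono' : MonotoneOn (deriv φ) (Set.Ici x) :=
      monotoneOn_of_deriv_nonneg (convex_Ici x) hdφ'.continuous.continuousOn
        hdφ'.differentiableOn fun y hy => by
          rw [heq]
          have := Vpot_add_nonneg_of_le hm hx.le (interior_subset hy : y ∈ Set.Ici x) hA
          have := hpos y
          positivity
    have hmono : MonotoneOn φ (Set.Ici x) :=
      monotoneOn_of_deriv_nonneg (convex_Ici x) hdφ.continuous.continuousOn
        hdφ.differentiableOn fun y hy =>
          have hy' : x ≤ y := interior_subset hy
          hge.trans (hmono' Set.self_mem_Ici hy' hy')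
    refine (hpos x).not_ge (ge_of_tendsto hlim ?_)
    filter_upwards [eventually_ge_atTop x] with y hy using hmono Set.self_mem_Ici hy hy
  · have hanti : StrictAntiOn (deriv φ) (Set.Icc 0 x) :=
      strictAntiOn_of_deriv_neg (convex_Icc 0 x) hdφ'.continuous.continuousOn fun y hy => by
        rw [interior_Icc] at hy
        rw [heq]
        refine mul_neg_of_neg_of_pos ?_ (hpos y)
        by_contra! hle
        exact hA.not_ge (Vpot_add_nonneg_of_le hm hy.1.le hy.2.le hle)
    have := hanti ⟨le_rfl, hx.le⟩ ⟨hx.le, le_rfl⟩ hx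
    linarith

theorem deriv_neg_of_even {f : ℝ → ℝ} (hf : ∀ x, f (-x) = f x) (x : ℝ) :
    deriv f (-x) = -deriv f x := by
  have h := deriv_comp_neg f x
  simp only [hf] at h
  linarith

theorem isRiccatiSolution_neg_logDeriv {φ : ℝ → ℝ} {m : ℝ} (hC2 : ContDiff ℝ 2 φ)
    (hpos : ∀ x, 0 < φ x) (heven : ∀ x, φ (-x) = φ x) (hm : 0 ≤ m)
    (heq : ∀ x, deriv (deriv φ) x = (Vpot x + m) * φ x) (hlim : Tendsto φ atTop (nhds 0)) :
    IsRiccatiSolution m fun x => -(deriv φ x / φ x) := by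
  have hφ0 : deriv φ 0 = 0 := by
    have h := deriv_neg_of_even heven 0
    rw [neg_zero] at h
    linarith
  have hdφ : Differentiable ℝ φ := hC2.differentiable (by norm_num)
  have hdφ' : Differentiable ℝ (deriv φ) := hC2.differentiable_deriv_two
  refine ⟨fun x => ?_, by simp [hφ0], fun {x} hx => ?_⟩
  · have hne := (hpos x).ne'
    refine ((hdφ' x).hasDerivAt.div (hdφ x).hasDerivAt hne).neg.congr_deriv ?_
    rw [heq]
    field_simp
    ring
  · rw [neg_pos]
    exact div_neg_of_neg_of_pos (deriv_neg_of_tendsto_zero hC2 hpos hm hφ0 heq hlim hx) (hpos x)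

/-- The derivative of the transformed potential
`V₀ = 2h₀² − 2μ₀² − V` is odd and non-positive on `[0,∞)`; in particular `V₀`
is repulsive. -/
theorem transformed_potential_repulsive (φ₀ : ℝ → ℝ) (μ₀ : ℝ)
    (hC2 : ContDiff ℝ 2 φ₀) (hpos : ∀ x : ℝ, 0 < φ₀ x)
    (heven : ∀ x : ℝ, φ₀ (-x) = φ₀ x)
    (hL2 : Integrable (fun x => (φ₀ x)^2))
    (hμ1 : (0.808:ℝ) ≤ μ₀) (hμ2 : μ₀ ≤ (0.883:ℝ))
    (heq : ∀ x : ℝ, -(deriv (deriv φ₀) x) + Vpot x * φ₀ x = -μ₀^2 * φ₀ x)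
    (hdecay : ∃ C > (0:ℝ), ∀ x : ℝ,
      |φ₀ x| + |deriv φ₀ x| ≤ C * Real.exp (-(Real.sqrt 2 / 2) * μ₀ * |x|)) :
    (∀ x : ℝ,
      deriv (fun y => 2 * (deriv φ₀ y / φ₀ y)^2 - 2 * μ₀^2 - Vpot y) (-x)
        = -(deriv (fun y => 2 * (deriv φ₀ y / φ₀ y)^2 - 2 * μ₀^2 - Vpot y) x)) ∧
    (∀ x : ℝ, 0 ≤ x →
      deriv (fun y => 2 * (deriv φ₀ y / φ₀ y)^2 - 2 * μ₀^2 - Vpot y) x ≤ 0) ∧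
    (∀ x : ℝ,
      x * deriv (fun y => 2 * (deriv φ₀ y / φ₀ y)^2 - 2 * μ₀^2 - Vpot y) x ≤ 0) := by
  have hm : 0.652864 ≤ μ₀ ^ 2 := by nlinarith
  have hm' : μ₀ ^ 2 ≤ 0.779689 := by nlinarith
  have hric := isRiccatiSolution_neg_logDeriv hC2 hpos heven (sq_nonneg μ₀)
    (fun x => by linarith [heq x]) (tendsto_zero_of_exp_decay (by linarith) hdecay)
  have hφ' := deriv_neg_of_even heven
  have hodd := deriv_neg_of_even (f := fun y => 2 * (deriv φ₀ y / φ₀ y)^2 - 2 * μ₀^2 - Vpot y)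
    fun x => by rw [hφ', heven, Vpot_neg, neg_div, neg_sq]
  have hnonpos (x : ℝ) (hx : 0 ≤ x) :
      deriv (fun y => 2 * (deriv φ₀ y / φ₀ y)^2 - 2 * μ₀^2 - Vpot y) x ≤ 0 := by
    have h := hric.hasDerivAt_potential x
    simp only [neg_sq] at h
    rw [h.deriv]
    simpa only [neg_sq] using hric.slope_nonpos hm hm' hx
  refine ⟨hodd, hnonpos, fun x => ?_⟩
  obtain hx | hx := le_total 0 x
  · exact mul_nonpos_of_nonneg_of_nonpos hx (hnonpos x hx)
  · have h := hnonpos (-x) (neg_nonneg.2 hx)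
    rw [hodd] at h
    exact mul_nonpos_of_nonpos_of_nonneg hx (by linarith)
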